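/- arXiv:0807.2832 — 2 statements merged into one kernel-verified Lean document; each statement's English description precedes it below -/
import Mathlib

section
/- Let d ≥ 1 be an integer, λ₀ > 0, and K ⊆ (0,∞) a compact set with λ₀ ∈ K. Let r_n : {1,…,d} → ℝ be a sequence of functions with r_n(h) → e^{−λ₀ h} as n → ∞ for each h = 1,…,d, and let λ_n ∈ K satisfy Δ_n(λ_n) = min_{λ ∈ K} Δ_n(λ) for each n. Then λ_n → λ₀ as n → ∞. (This is the deterministic core of the paper's Lemma 3.3.) -/
open Filter

/-- Deterministic core of Lemma 3.3: if `r n h → exp (−λ₀ h)` for each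
`h = 1, …, d`, `K ⊆ (0,∞)` is compact with `λ₀ ∈ K`, and `lam n ∈ K`
minimizes `Δₙ(λ) = ∑_{h=1}^d (r n h − exp (−λ h))²` over `K`,
then `lam n → λ₀`. -/
theorem argmin_tendsto_of_pointwise_tendsto
    (d : ℕ) (hd : 1 ≤ d) (lam0 : ℝ) (hlam0 : 0 < lam0)
    (K : Set ℝ) (hK : IsCompact K) (hKpos : K ⊆ Set.Ioi (0 : ℝ)) (hlamK : lam0 ∈ K)
    (r : ℕ → ℕ → ℝ)
    (hr : ∀ h ∈ Finset.Icc 1 d,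
      Tendsto (fun n : ℕ => r n h) atTop (nhds (Real.exp (-lam0 * h))))
    (lam : ℕ → ℝ) (hmem : ∀ n, lam n ∈ K)
    (hmin : ∀ n, IsMinOn
      (fun l : ℝ => ∑ h ∈ Finset.Icc 1 d, (r n h - Real.exp (-l * h)) ^ 2)
      K (lam n)) :
    Tendsto lam atTop (nhds lam0) := by
  have h1 : 1 ∈ Finset.Icc 1 d := Finset.mem_Icc.mpr ⟨le_rfl, hd⟩
  have hΔ : Tendsto
      (fun n => ∑ h ∈ Finset.Icc 1 d, (r n h - Real.exp (-lam0 * h)) ^ 2) atTop (nhds 0) := by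
    simpa using tendsto_finsetSum (Finset.Icc 1 d) fun h hh =>
      ((hr h hh).sub_const (Real.exp (-lam0 * h))).pow 2
  have hbound : ∀ n, (r n 1 - Real.exp (-lam n)) ^ 2 ≤
      ∑ h ∈ Finset.Icc 1 d, (r n h - Real.exp (-lam0 * h)) ^ 2 := fun n => by
    have hterm := Finset.single_le_sum
      (f := fun h : ℕ => (r n h - Real.exp (-lam n * h)) ^ 2) (fun _ _ => sq_nonneg _) h1
    simp only [Nat.cast_one, mul_one] at hterm
    exact hterm.trans (isMinOn_iff.mp (hmin n) lam0 hlamK)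
  have hsq : Tendsto (fun n => (r n 1 - Real.exp (-lam n)) ^ 2) atTop (nhds 0) :=
    squeeze_zero (fun _ => sq_nonneg _) hbound hΔ
  have hdiff : Tendsto (fun n => r n 1 - Real.exp (-lam n)) atTop (nhds 0) := by
    rw [tendsto_zero_iff_abs_tendsto_zero]
    simpa [Function.comp_def, Real.sqrt_sq_eq_abs] using hsq.sqrt
  have hexp : Tendsto (fun n => Real.exp (-lam n)) atTop (nhds (Real.exp (-lam0))) := by
    simpa using (hr 1 h1).sub hdiff
  simpa using (hexp.log (Real.exp_ne_zero _)).neg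
end

section
/- Let a, b > 0 and define Γ⁺(y) = (a/√(2π)) · y^{−1/2} · e^{−b² y/2} for y > 0. Then for every x > 0: (i) there exists a unique y* > 0 with Γ⁺(y*) = x; (ii) y* = inf{ y > 0 : Γ⁺(y) ≤ x }; and (iii) w := b² y* satisfies w e^{w} = a² b²/(2π x²), i.e. y* = (1/b²)·W(a² b²/(2π x²)), where W is the Lambert-W function (the inverse of w ↦ w e^w on [0,∞)). (This is formula (ITMF3) for the inverse tail mass function of the BDLP of the IG(a,b) Ornstein–Uhlenbeck model in the paper's Section 5.2.) -/
open Real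

lemma mul_exp_strictMonoOn (b : ℝ) :
    StrictMonoOn (fun y : ℝ => y * Real.exp (b ^ 2 * y)) (Set.Ioi 0) := by
  intro y hy z hz hyz
  have hexp : Real.exp (b ^ 2 * y) ≤ Real.exp (b ^ 2 * z) := by gcongr
  exact mul_lt_mul hyz hexp (Real.exp_pos _) (le_of_lt hz)

lemma exists_mul_exp_eq (b : ℝ) {c : ℝ} (hc : 0 < c) :
    ∃ y : ℝ, 0 < y ∧ y * Real.exp (b ^ 2 * y) = c := by
  have hcont : ContinuousOn (fun y : ℝ => y * Real.exp (b ^ 2 * y)) (Set.Icc 0 c) := by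
    fun_prop
  have hle : c ≤ c * Real.exp (b ^ 2 * c) :=
    le_mul_of_one_le_right hc.le (Real.one_le_exp (by positivity))
  obtain ⟨y, hy, hyc⟩ := intermediate_value_Icc hc.le hcont ⟨by simpa using hc.le, hle⟩
  refine ⟨y, lt_of_le_of_ne hy.1 ?_, hyc⟩
  rintro rfl
  simp only [zero_mul] at hyc
  exact hc.ne hyc

lemma tail_mass_sq (a b : ℝ) {y : ℝ} (hy : 0 < y) :
    (a / Real.sqrt (2 * π) * y ^ (-(1 : ℝ) / 2) * Real.exp (-b ^ 2 * y / 2)) ^ 2 =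
      a ^ 2 / (2 * π * (y * Real.exp (b ^ 2 * y))) := by
  have hpow : (y ^ (-(1 : ℝ) / 2)) ^ 2 = y⁻¹ := by
    rw [← Real.rpow_natCast, ← Real.rpow_mul hy.le]
    norm_num [Real.rpow_neg_one]
  have hexp : Real.exp (-b ^ 2 * y / 2) ^ 2 = (Real.exp (b ^ 2 * y))⁻¹ := by
    rw [← Real.exp_nat_mul, ← Real.exp_neg]
    congr 1
    push_cast
    ring
  rw [mul_pow, mul_pow, div_pow, Real.sq_sqrt (by positivity), hpow, hexp]
  field_simp

lemma tail_mass_le_iff {a x : ℝ} (b : ℝ) (ha : 0 < a) (hx : 0 < x) {y : ℝ} (hy : 0 < y) :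
    a / Real.sqrt (2 * π) * y ^ (-(1 : ℝ) / 2) * Real.exp (-b ^ 2 * y / 2) ≤ x ↔
      a ^ 2 / (2 * π * x ^ 2) ≤ y * Real.exp (b ^ 2 * y) := by
  rw [← pow_le_pow_iff_left₀ (by positivity) hx.le two_ne_zero, tail_mass_sq a b hy,
    div_le_iff₀ (by positivity), div_le_iff₀ (by positivity)]
  ring_nf

lemma tail_mass_eq_iff {a x : ℝ} (b : ℝ) (ha : 0 < a) (hx : 0 < x) {y : ℝ} (hy : 0 < y) :
    a / Real.sqrt (2 * π) * y ^ (-(1 : ℝ) / 2) * Real.exp (-b ^ 2 * y / 2) = x ↔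
      y * Real.exp (b ^ 2 * y) = a ^ 2 / (2 * π * x ^ 2) := by
  rw [← pow_left_inj₀ (by positivity) hx.le two_ne_zero, tail_mass_sq a b hy,
    div_eq_iff (by positivity), eq_div_iff (by positivity), eq_comm]
  ring_nf

/-- Formula (ITMF3) of Section 5.2: for the tail mass function
`Γ⁺(y) = (a/√(2π)) y^{−1/2} e^{−b² y/2}` and any `x > 0`, there is a unique
`y* > 0` with `Γ⁺(y*) = x`; it equals the generalized inverse
`inf {y > 0 : Γ⁺(y) ≤ x}`, and `w = b² y*` solves the Lambert-W equation
`w e^w = a² b²/(2π x²)`. -/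
theorem IG_OU_inverse_tail_mass_function
    (a b x : ℝ) (ha : 0 < a) (hb : 0 < b) (hx : 0 < x) :
    (∃! y : ℝ, 0 < y ∧
      a / Real.sqrt (2 * π) * y ^ (-(1 : ℝ) / 2) * Real.exp (-b ^ 2 * y / 2) = x) ∧
    (∀ y : ℝ, 0 < y →
      a / Real.sqrt (2 * π) * y ^ (-(1 : ℝ) / 2) * Real.exp (-b ^ 2 * y / 2) = x →
      y = sInf {z : ℝ | 0 < z ∧
            a / Real.sqrt (2 * π) * z ^ (-(1 : ℝ) / 2) * Real.exp (-b ^ 2 * z / 2) ≤ x} ∧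
        (b ^ 2 * y) * Real.exp (b ^ 2 * y) = a ^ 2 * b ^ 2 / (2 * π * x ^ 2)) := by
  have hmono := mul_exp_strictMonoOn b
  refine ⟨?_, fun y hy hyx => ?_⟩
  · obtain ⟨y, hy, hyc⟩ := exists_mul_exp_eq b (c := a ^ 2 / (2 * π * x ^ 2)) (by positivity)
    refine ⟨y, ⟨hy, (tail_mass_eq_iff b ha hx hy).2 hyc⟩, ?_⟩
    rintro z ⟨hz, hzx⟩
    exact hmono.injOn hz hy (((tail_mass_eq_iff b ha hx hz).1 hzx).trans hyc.symm)
  · have hyc := (tail_mass_eq_iff b ha hx hy).1 hyx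
    constructor
    · have hset : {z : ℝ | 0 < z ∧ a / Real.sqrt (2 * π) * z ^ (-(1 : ℝ) / 2) *
          Real.exp (-b ^ 2 * z / 2) ≤ x} = Set.Ici y := by
        ext z
        simp only [Set.mem_ofPred_eq, Set.mem_Ici]
        constructor
        · rintro ⟨hz, hzx⟩
          rw [tail_mass_le_iff b ha hx hz, ← hyc] at hzx
          exact (hmono.le_iff_le hy hz).1 hzx
        · intro hyz
          have hz := hy.trans_le hyz
          refine ⟨hz, ?_⟩
          rw [tail_mass_le_iff b ha hx hz, ← hyc]
          exact (hmono.le_iff_le hy hz).2 hyz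
      rw [hset, csInf_Ici]
    · rw [mul_assoc, hyc]
      ring
end
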